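/- Let F be a totally real number field of degree n, σ : F → ℝ a real embedding, and N = N_{F/ℚ} the field norm. Let r ≥ 1 be an integer, z ∈ F totally positive, v_1, …, v_r ∈ F totally positive, and let ξ_1, …, ξ_r ∈ ℂ be roots of unity with ξ_j ≠ 1 for all j. Let f be analytic on a connected open set containing 0 and the half-plane {s : Re(s) > r}, agreeing there with ∑_{m ∈ (ℤ_{≥0})^r} (∏ ξ_j^{m_j}) (N(z + m·v))^{−s}, and let g be analytic on a connected open set containing 0 and the half-plane {s : Re(s) > r}, agreeing there with ∑_{m ∈ (ℤ_{≥0})^r} (∏ ξ_j^{m_j}) σ(z + m·v)^{−s}, where m·v := m_1 v_1 + … + m_r v_r. Then f(0) = g(0); i.e., the root-of-unity-twisted Shintani zeta function with the norm and the one without the norm have the same value at s = 0. -/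

import Mathlib

/-- A number field is totally real if every complex embedding takes real values. -/
def IsTotallyRealField (F : Type*) [Field F] : Prop :=
  ∀ φ : F →+* ℂ, ∀ x : F, (φ x).im = 0

theorem fwdDiff_iter_succ_const {M G : Type*} [AddCommMonoid M] [AddCommGroup G] (h : M) (c : G)
    (k : ℕ) : (fwdDiff h)^[k + 1] (fun _ : M => c) = fun _ => 0 := by
  induction k with
  | zero => simp
  | succ k ih => rw [Function.iterate_succ_apply', ih, fwdDiff_const]

theorem Summable.pow_mul_of_norm_le_one {ξ : ℂ} (hξ : ‖ξ‖ ≤ 1) {ψ : ℕ → ℂ} (hψ : Summable ψ) :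
    Summable fun a => ξ ^ a * ψ a := by
  refine Summable.of_norm_bounded hψ.norm fun a => ?_
  rw [norm_mul, norm_pow]
  exact mul_le_of_le_one_left (norm_nonneg _) (pow_le_one₀ (norm_nonneg _) hξ)

theorem Summable.fwdDiff_one {ψ : ℕ → ℂ} (hψ : Summable ψ) : Summable (fwdDiff 1 ψ) :=
  ((summable_nat_add_iff 1).2 hψ).sub hψ

theorem Summable.fwdDiff_one_iter {ψ : ℕ → ℂ} (hψ : Summable ψ) (k : ℕ) :
    Summable ((fwdDiff 1)^[k] ψ) := by
  induction k with
  | zero => exact hψ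
  | succ k ih => rw [Function.iterate_succ_apply']; exact ih.fwdDiff_one

/-- Abel summation for a power series on the closed unit disc away from `1`. -/
theorem tsum_pow_mul_eq_fwdDiff {ξ : ℂ} (hξ : ‖ξ‖ ≤ 1) (hne : ξ ≠ 1) {ψ : ℕ → ℂ}
    (hψ : Summable ψ) :
    ∑' a, ξ ^ a * ψ a = ψ 0 / (1 - ξ) + ξ / (1 - ξ) * ∑' a, ξ ^ a * fwdDiff 1 ψ a := by
  have hsub : (1 - ξ) ≠ 0 := sub_ne_zero.2 hne.symm
  have hsum := hψ.pow_mul_of_norm_le_one hξ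
  have hshift : Summable fun a => ξ ^ a * ψ (a + 1) :=
    Summable.pow_mul_of_norm_le_one (ψ := fun a => ψ (a + 1)) hξ ((summable_nat_add_iff 1).2 hψ)
  have h0 : ∑' a, ξ ^ a * ψ a = ψ 0 + ξ * ∑' a, ξ ^ a * ψ (a + 1) := by
    rw [hsum.tsum_eq_zero_add, ← tsum_mul_left]
    simp [pow_succ', mul_assoc]
  have h1 : ∑' a, ξ ^ a * fwdDiff 1 ψ a = ∑' a, ξ ^ a * ψ (a + 1) - ∑' a, ξ ^ a * ψ a := by
    rw [← hshift.tsum_sub hsum]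
    simp [fwdDiff, mul_sub]
  rw [h1]
  field_simp
  linear_combination h0

theorem tsum_pow_mul_eq_sum_fwdDiff_iter {ξ : ℂ} (hξ : ‖ξ‖ ≤ 1) (hne : ξ ≠ 1) {ψ : ℕ → ℂ}
    (hψ : Summable ψ) (K : ℕ) :
    ∑' a, ξ ^ a * ψ a =
      ∑ k ∈ Finset.range K, ξ ^ k / (1 - ξ) ^ (k + 1) * (fwdDiff 1)^[k] ψ 0 +
        (ξ / (1 - ξ)) ^ K * ∑' a, ξ ^ a * (fwdDiff 1)^[K] ψ a := by
  have hsub : (1 - ξ) ≠ 0 := sub_ne_zero.2 hne.symm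
  induction K with
  | zero => simp
  | succ K ih =>
    rw [ih, tsum_pow_mul_eq_fwdDiff hξ hne (hψ.fwdDiff_one_iter K), Finset.sum_range_succ,
      Function.iterate_succ_apply']
    generalize ∑ k ∈ Finset.range K, ξ ^ k / (1 - ξ) ^ (k + 1) * (fwdDiff 1)^[k] ψ 0 = S
    rw [div_pow, div_pow, pow_succ, pow_succ]
    field_simp
    ring

theorem fwdDiff_iter_tsum {β : Type*} {G : ℕ → β → ℂ} (hG : ∀ a, Summable (G a)) (K a : ℕ) :
    (fwdDiff 1)^[K] (fun b => ∑' m, G b m) a = ∑' m, (fwdDiff 1)^[K] (fun b => G b m) a := by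
  simp only [fwdDiff_iter_eq_sum_shift]
  rw [Summable.tsum_finsetSum fun k _ => (hG _).const_smul _]
  refine Finset.sum_congr rfl fun k _ => ?_
  rw [← Summable.tsum_const_smul _ (hG _)]

theorem fwdDiff_iter_mul_left {M : Type*} [AddCommMonoid M] (h : M) (c : ℂ) (φ : M → ℂ) (K : ℕ)
    (a : M) : (fwdDiff h)^[K] (fun b => c * φ b) a = c * (fwdDiff h)^[K] φ a := by
  simpa [Pi.smul_def] using congrFun (fwdDiff_iter_const_smul h c φ K) a

theorem differentiable_fwdDiff_iter {M : Type*} [AddCommMonoid M] (h : M) {S : Set ℂ}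
    {φ : M → ℂ → ℂ} (hφ : ∀ b, DifferentiableOn ℂ (φ b) S) (K : ℕ) (a : M) :
    DifferentiableOn ℂ (fun s => (fwdDiff h)^[K] (fun b => φ b s) a) S := by
  simp only [fwdDiff_iter_eq_sum_shift]
  exact DifferentiableOn.fun_sum fun k _ => (hφ _).const_smul _

theorem norm_fwdDiff_iter_le {R M : ℝ} (K : ℕ) {h : ℂ → ℂ}
    (hh : DifferentiableOn ℂ h {w | -R < w.re}) {x : ℂ} (hx : -R < x.re)
    (hM : ∀ t ∈ Set.Icc (0 : ℝ) K, ‖iteratedDeriv K h (x + t)‖ ≤ M) :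
    ‖(fwdDiff 1)^[K] h x‖ ≤ M := by
  induction K generalizing h with
  | zero => simpa using hM 0 (by simp)
  | succ K ih =>
    have hopen : IsOpen {w : ℂ | -R < w.re} := isOpen_lt continuous_const Complex.continuous_re
    have hcd : ∀ w : ℂ, -R < w.re → ∀ n : WithTop ℕ∞, ContDiffAt ℂ n h w := fun w hw n =>
      (hh.contDiffOn hopen).contDiffAt (hopen.mem_nhds hw)
    have hshift : DifferentiableOn ℂ (fun w => h (w + 1)) {w | -R < w.re} := by
      refine hh.comp (by fun_prop) fun w hw => ?_
      simp only [Set.mem_ofPred_eq, Complex.add_re, Complex.one_re] at hw ⊢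
      linarith
    rw [Function.iterate_succ_apply]
    refine ih (hshift.sub hh) fun t ht => ?_
    have hre : -R < (x + t).re := by simp; linarith [ht.1]
    have h1 : iteratedDeriv K (fwdDiff 1 h) (x + t) =
        iteratedDeriv K h (x + t + 1) - iteratedDeriv K h (x + t) := by
      have := iteratedDeriv_fun_sub (n := K) (x := x + t) (f := fun w => h (w + 1)) (g := h)
        ((hshift.contDiffOn hopen).contDiffAt (hopen.mem_nhds hre)) (hcd _ hre _)
      rw [iteratedDeriv_comp_add_const] at this
      exact this
    rw [h1]
    have key := Convex.norm_image_sub_le_of_norm_deriv_le (𝕜 := ℂ) (f := iteratedDeriv K h)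
      (s := segment ℝ (x + t) (x + t + 1)) (C := M) (x := x + t) (y := x + t + 1) ?_ ?_
      (convex_segment _ _) (left_mem_segment _ _ _) (right_mem_segment _ _ _)
    · simpa using key
    all_goals
      intro w hw
      rw [segment_eq_image'] at hw
      obtain ⟨θ, hθ, rfl⟩ := hw
      have hw' : x + t + θ • (x + t + 1 - (x + t)) = x + ((t + θ : ℝ) : ℂ) := by
        push_cast; rw [Complex.real_smul]; ring
      simp only [hw']
    · have : -R < (x + ((t + θ : ℝ) : ℂ)).re := by
        simp; linarith [ht.1, hθ.1]
      exact (iteratedDeriv_eq_iterate (𝕜 := ℂ) (f := h) (n := K)) ▸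
        (AnalyticAt.iterated_deriv (hh.analyticAt (hopen.mem_nhds this)) K).differentiableAt
    · rw [← iteratedDeriv_succ]
      refine hM _ ⟨by linarith [ht.1, hθ.1], ?_⟩
      push_cast
      linarith [ht.2, hθ.2]

theorem summable_inv_one_add_sum_pow (r : ℕ) :
    Summable fun m : Fin r → ℕ => ((1 + ∑ j, (m j : ℝ)) ^ (2 * r))⁻¹ := by
  have hprod : Summable fun m : Fin r → ℕ => ∏ j, ((1 + (m j : ℝ)) ^ 2)⁻¹ := by
    induction r with
    | zero => exact Summable.of_finite
    | succ r ih =>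
      rw [← (Fin.consEquiv fun _ => ℕ).summable_iff]
      have h1 : Summable fun a : ℕ => ((1 + (a : ℝ)) ^ 2)⁻¹ := by
        have := (summable_nat_add_iff 1).2 (Real.summable_nat_pow_inv.2 (one_lt_two))
        simpa [add_comm] using this
      refine (h1.mul_of_nonneg ih (fun _ => by positivity)
        (fun _ => Finset.prod_nonneg fun _ _ => by positivity)).congr fun p => ?_
      simp [Fin.prod_univ_succ, mul_comm]
  refine Summable.of_nonneg_of_le (fun m => by positivity) (fun m => ?_) hprod
  rw [Finset.prod_inv_distrib]
  refine inv_anti₀ (Finset.prod_pos fun _ _ => by positivity) ?_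
  calc ∏ j, (1 + (m j : ℝ)) ^ 2 ≤ ∏ _j : Fin r, (1 + ∑ j, (m j : ℝ)) ^ 2 := by
        refine Finset.prod_le_prod (fun _ _ => by positivity) fun j _ => ?_
        gcongr
        exact Finset.single_le_sum (f := fun j => (m j : ℝ)) (fun _ _ => by positivity)
          (Finset.mem_univ j)
    _ = _ := by simp [pow_mul]

/-- The function `s ↦ (∏ i, x i) ^ (-s)` for a positive real vector `x`. -/
noncomputable def prodNegPow {ι : Type*} [Fintype ι] (x : ι → ℝ) (s : ℂ) : ℂ :=
  Complex.exp (-s * ∑ i, (Real.log (x i) : ℂ))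

section prodNegPow

variable {ι : Type*} [Fintype ι]

@[simp]
theorem prodNegPow_zero (x : ι → ℝ) : prodNegPow x 0 = 1 := by simp [prodNegPow]

theorem differentiable_prodNegPow (x : ι → ℝ) : Differentiable ℂ (prodNegPow x) := by
  unfold prodNegPow
  fun_prop

theorem norm_log_le_log_add {c C N : ℝ} (hc : 0 < c) (hC : 0 < C) (hN : 1 ≤ N) {X : ℂ}
    (h1 : c * N ≤ ‖X‖) (h2 : ‖X‖ ≤ C * N) :
    ‖Complex.log X‖ ≤ Real.log N + (|Real.log c| + |Real.log C| + Real.pi) := by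
  have hN0 : 0 < N := by linarith
  have hX : 0 < ‖X‖ := lt_of_lt_of_le (by positivity) h1
  have l1 := Real.log_le_log (by positivity) h1
  have l2 := Real.log_le_log hX h2
  rw [Real.log_mul (by positivity) (by positivity)] at l1 l2
  have hlogN := Real.log_nonneg hN
  have hre : |Real.log ‖X‖| ≤ Real.log N + (|Real.log c| + |Real.log C|) := by
    rw [abs_le]
    constructor <;>
      linarith [neg_abs_le (Real.log c), le_abs_self (Real.log C), abs_nonneg (Real.log c),
        abs_nonneg (Real.log C)]
  refine (Complex.norm_le_abs_re_add_abs_im _).trans ?_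
  rw [Complex.log_re, Complex.log_im]
  linarith [Complex.abs_arg_le_pi X]

theorem norm_exp_sum_log_le {c C N A : ℝ} (hc : 0 < c) (hC : 0 < C) (hN : 1 ≤ N) (hA : 0 ≤ A)
    {k : ℕ} (hk : A * Fintype.card ι ≤ k) {X : ι → ℂ}
    (hX : ∀ i, c * N ≤ ‖X i‖ ∧ ‖X i‖ ≤ C * N) {s : ℂ} (hs : ‖s‖ ≤ A) :
    ‖Complex.exp (-s * ∑ i, Complex.log (X i))‖ ≤
      Real.exp (k * (|Real.log c| + |Real.log C| + Real.pi)) * N ^ k := by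
  have hN0 : 0 < N := by linarith
  set b := |Real.log c| + |Real.log C| + Real.pi with hb
  have hb0 : 0 ≤ b := by positivity
  have hlogN := Real.log_nonneg hN
  have hsum : ‖∑ i, Complex.log (X i)‖ ≤ Fintype.card ι * (Real.log N + b) := by
    refine (norm_sum_le_of_le _ fun i _ =>
      norm_log_le_log_add hc hC hN (hX i).1 (hX i).2).trans (le_of_eq ?_)
    rw [Finset.sum_const, nsmul_eq_mul, Finset.card_univ]
  calc ‖Complex.exp (-s * ∑ i, Complex.log (X i))‖
      ≤ Real.exp (‖-s * ∑ i, Complex.log (X i)‖) := Complex.norm_exp_le_exp_norm _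
    _ ≤ Real.exp (k * b + k * Real.log N) := by
        refine Real.exp_le_exp.2 ?_
        rw [norm_mul, norm_neg]
        calc _ ≤ A * (Fintype.card ι * (Real.log N + b)) := by gcongr
          _ = A * Fintype.card ι * (Real.log N + b) := by ring
          _ ≤ k * (Real.log N + b) := by gcongr
          _ = _ := by ring
    _ = _ := by
        rw [Real.exp_add, Real.exp_nat_mul (Real.log N), Real.exp_log hN0]

/-- Each finite difference in a positive direction gains one power of the size of the base
point. -/
theorem exists_bound_fwdDiff_iter_prodNegPow {c C A : ℝ} (hc : 0 < c) (hC : 0 < C) (hA : 0 ≤ A)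
    {k : ℕ} (hk : A * Fintype.card ι ≤ k) (q : ℕ) :
    ∃ B : ℝ, ∀ N : ℝ, 1 ≤ N → ∀ x v : ι → ℝ, (∀ i, c * N ≤ x i ∧ x i ≤ C * N) →
      (∀ i, 0 < v i ∧ v i ≤ C) → ∀ s : ℂ, ‖s‖ ≤ A →
      ‖(fwdDiff 1)^[k + q] (fun a : ℕ => prodNegPow (x + a • v) s) 0‖ ≤ B * (N ^ q)⁻¹ := by
  set K := k + q
  set C' := C + K * C + c / 2 with hC'
  have hC'0 : 0 < C' := by positivity
  set b := |Real.log (c / 2)| + |Real.log C'| + Real.pi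
  refine ⟨K.factorial * Real.exp (k * b) / (c / C / 2) ^ K, fun N hN x v hx hv s hs => ?_⟩
  have hN0 : 0 < N := by linarith
  set R := c / C * N with hR
  have hR0 : 0 < R := by positivity
  have hRC : R * C = c * N := by rw [hR]; field_simp
  set h : ℂ → ℂ := fun w => Complex.exp (-s * ∑ i, Complex.log (x i + w * v i)) with hh
  have hRv : ∀ i, R * v i ≤ c * N := fun i => by
    rw [← hRC]; exact mul_le_mul_of_nonneg_left (hv i).2 hR0.le
  have hdiff : DifferentiableOn ℂ h {w | -R < w.re} := by
    intro w hw
    refine DifferentiableAt.differentiableWithinAt ?_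
    refine DifferentiableAt.cexp (DifferentiableAt.const_mul
      (DifferentiableAt.fun_sum fun i _ => ?_) _)
    refine DifferentiableAt.clog (by fun_prop) (Or.inl ?_)
    simp only [Set.mem_ofPred_eq, Complex.add_re, Complex.ofReal_re, Complex.mul_re,
      Complex.ofReal_im, mul_zero, sub_zero] at hw ⊢
    nlinarith [hRv i, (hx i).1, (hv i).1]
  have hcongr : (fwdDiff 1)^[K] (fun a : ℕ => prodNegPow (x + a • v) s) 0 =
      (fwdDiff 1)^[K] h 0 := by
    rw [fwdDiff_iter_eq_sum_shift, fwdDiff_iter_eq_sum_shift]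
    refine Finset.sum_congr rfl fun l _ => ?_
    congr 1
    simp only [prodNegPow, hh]
    congr 2
    refine Finset.sum_congr rfl fun i _ => ?_
    have : 0 ≤ x i + l * v i := by
      have := (hx i).1
      have := (hv i).1
      have : 0 ≤ c * N := by positivity
      have : 0 ≤ l * v i := by positivity
      linarith
    simp [Complex.ofReal_log this]
  rw [hcongr]
  refine norm_fwdDiff_iter_le K hdiff (by simpa using hR0) fun t ht => ?_
  have hball : ∀ w ∈ Metric.closedBall ((0 : ℂ) + t) (R / 2),
      -(R / 2) ≤ w.re ∧ ‖w‖ ≤ K + R / 2 := by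
    intro w hw
    rw [mem_closedBall_iff_norm, zero_add] at hw
    have h1 := (Complex.abs_re_le_norm (w - t)).trans hw
    have h2 : ‖w‖ ≤ ‖w - t‖ + ‖(t : ℂ)‖ := by simpa using norm_add_le (w - t) (t : ℂ)
    rw [Complex.norm_real, Real.norm_of_nonneg ht.1] at h2
    simp only [Complex.sub_re, Complex.ofReal_re] at h1
    exact ⟨by linarith [(abs_le.1 h1).1, ht.1], by linarith [ht.2]⟩
  have hcauchy := Complex.norm_iteratedDeriv_le_of_forall_mem_sphere_norm_le (f := h)
    (c := (0 : ℂ) + t) (R := R / 2) (C := Real.exp (k * b) * N ^ k) K (by positivity) ?_ ?_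
  · refine hcauchy.trans (le_of_eq ?_)
    rw [hR, show c / C * N / 2 = c / C / 2 * N by ring, mul_pow, pow_add N k q]
    field_simp
  · refine DifferentiableOn.diffContOnCl ?_
    refine hdiff.mono ((closure_mono Metric.ball_subset_closedBall).trans ?_)
    rw [Metric.isClosed_closedBall.closure_eq]
    intro w hw
    have := (hball w hw).1
    simp only [Set.mem_ofPred_eq]
    linarith
  · intro w hw
    obtain ⟨hre, hnorm⟩ := hball w (Metric.sphere_subset_closedBall hw)
    refine norm_exp_sum_log_le (by positivity) hC'0 hN hA hk (fun i => ⟨?_, ?_⟩) hs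
    · refine le_trans ?_ (Complex.re_le_norm _)
      simp only [Complex.add_re, Complex.ofReal_re, Complex.mul_re, Complex.ofReal_im, mul_zero,
        sub_zero]
      nlinarith [hRv i, (hx i).1, (hv i).1]
    · have hxi : 0 < x i := lt_of_lt_of_le (by positivity) (hx i).1
      calc ‖(x i : ℂ) + w * v i‖ ≤ ‖(x i : ℂ)‖ + ‖w‖ * ‖(v i : ℂ)‖ := by
            rw [← norm_mul]; exact norm_add_le _ _
        _ = x i + ‖w‖ * v i := by
            rw [Complex.norm_real, Complex.norm_real, Real.norm_of_nonneg hxi.le,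
              Real.norm_of_nonneg (hv i).1.le]
        _ ≤ C * N + (K + R / 2) * C := by
            gcongr
            · exact (hx i).2
            · exact (hv i).1.le
            · exact (hv i).2
        _ = C * N + K * C * 1 + c / 2 * N := by linear_combination hRC / 2
        _ ≤ C * N + K * C * N + c / 2 * N := by gcongr
        _ = C' * N := by rw [hC']; ring

theorem norm_prodNegPow_le [Nonempty ι] {c N : ℝ} (hc : 0 < c) (hN : 1 ≤ N) {x : ι → ℝ}
    (hx : ∀ i, c * N ≤ x i) {s : ℂ} {q : ℕ} (hs : (q : ℝ) ≤ s.re) :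
    ‖prodNegPow x s‖ ≤ Real.exp (-s.re * (Fintype.card ι * Real.log c)) * (N ^ q)⁻¹ := by
  have hN0 : 0 < N := by linarith
  have hq : (0 : ℝ) ≤ s.re := (Nat.cast_nonneg q).trans hs
  have hlogN := Real.log_nonneg hN
  have hcard : (1 : ℝ) ≤ Fintype.card ι := by exact_mod_cast Fintype.card_pos
  have hsum : Fintype.card ι * (Real.log c + Real.log N) ≤ ∑ i, Real.log (x i) := by
    rw [← nsmul_eq_mul, ← Finset.card_univ]
    refine Finset.card_nsmul_le_sum _ _ _ fun i _ => ?_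
    rw [← Real.log_mul (by positivity) (by positivity)]
    exact Real.log_le_log (by positivity) (hx i)
  rw [prodNegPow, Complex.norm_exp, ← Complex.ofReal_sum, Complex.re_mul_ofReal, Complex.neg_re]
  have hpow : (N ^ q)⁻¹ = Real.exp (-(q * Real.log N)) := by
    rw [Real.exp_neg, Real.exp_nat_mul, Real.exp_log hN0]
  rw [hpow, ← Real.exp_add]
  refine Real.exp_le_exp.2 ?_
  have h1 := mul_le_mul_of_nonneg_left hsum hq
  have h2 : q * Real.log N ≤ s.re * (Fintype.card ι * Real.log N) :=
    mul_le_mul hs (le_mul_of_one_le_left hlogN hcard) hlogN hq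
  linarith

end prodNegPow

section shintani

variable {ι : Type*} [Fintype ι]

theorem exists_pos_bounds {κ : Type*} [Finite κ] (y : κ → ℝ) (hy : ∀ k, 0 < y k) :
    ∃ c C : ℝ, 0 < c ∧ 0 < C ∧ ∀ k, c ≤ y k ∧ y k ≤ C := by
  rcases isEmpty_or_nonempty κ with h | h
  · exact ⟨1, 1, one_pos, one_pos, fun k => h.elim k⟩
  · obtain ⟨a, ha⟩ := Finite.exists_min y
    obtain ⟨b, hb⟩ := Finite.exists_max y
    exact ⟨y a, y b, hy a, hy b, fun k => ⟨ha k, hb k⟩⟩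

theorem exists_linear_bounds {r : ℕ} {z : ι → ℝ} (hz : ∀ i, 0 < z i) {v : Fin r → ι → ℝ}
    (hv : ∀ j i, 0 < v j i) :
    ∃ c C : ℝ, 0 < c ∧ 0 < C ∧ (∀ j i, v j i ≤ C) ∧ ∀ (m : Fin r → ℕ) (i : ι),
      c * (1 + ∑ j, (m j : ℝ)) ≤ (z + ∑ j, m j • v j) i ∧
        (z + ∑ j, m j • v j) i ≤ C * (1 + ∑ j, (m j : ℝ)) := by
  obtain ⟨c, C, hc, hC, h⟩ := exists_pos_bounds
    (Sum.elim z fun p : Fin r × ι => v p.1 p.2) (by rintro (i | p) <;> simp [hz, hv])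
  have hzb := fun i => h (Sum.inl i)
  have hvb := fun j i => h (Sum.inr (j, i))
  simp only [Sum.elim_inl, Sum.elim_inr] at hzb hvb
  refine ⟨c, C, hc, hC, fun j i => (hvb j i).2, fun m i => ?_⟩
  simp only [Pi.add_apply, Finset.sum_apply, nsmul_eq_mul, mul_add, mul_one,
    Finset.mul_sum]
  constructor
  · refine add_le_add (hzb i).1 (Finset.sum_le_sum fun j _ => ?_)
    rw [mul_comm]
    exact mul_le_mul_of_nonneg_left (hvb j i).1 (Nat.cast_nonneg _)
  · refine add_le_add (hzb i).2 (Finset.sum_le_sum fun j _ => ?_)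
    rw [mul_comm C]
    exact mul_le_mul_of_nonneg_left (hvb j i).2 (Nat.cast_nonneg _)

theorem one_le_one_add_sum {r : ℕ} (m : Fin r → ℕ) : (1 : ℝ) ≤ 1 + ∑ j, (m j : ℝ) :=
  le_add_of_nonneg_right (Finset.sum_nonneg fun _ _ => Nat.cast_nonneg _)

theorem summable_prodNegPow [Nonempty ι] {r : ℕ} {z : ι → ℝ} (hz : ∀ i, 0 < z i)
    {v : Fin r → ι → ℝ} (hv : ∀ j i, 0 < v j i) {s : ℂ} (hs : ((2 * r : ℕ) : ℝ) ≤ s.re) :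
    Summable fun m : Fin r → ℕ => prodNegPow (z + ∑ j, m j • v j) s := by
  obtain ⟨c, C, hc, -, -, h⟩ := exists_linear_bounds hz hv
  exact Summable.of_norm_bounded ((summable_inv_one_add_sum_pow r).mul_left _) fun m =>
    norm_prodNegPow_le hc (one_le_one_add_sum m) (fun i => (h m i).1) hs

theorem norm_prod_pow_le_one {r : ℕ} {ξ : Fin r → ℂ} (hξ : ∀ j, ‖ξ j‖ ≤ 1) (m : Fin r → ℕ) :
    ‖∏ j, ξ j ^ m j‖ ≤ 1 := by
  rw [norm_prod]
  refine Finset.prod_le_one (fun _ _ => norm_nonneg _) fun j _ => ?_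
  rw [norm_pow]
  exact pow_le_one₀ (norm_nonneg _) (hξ j)

theorem sum_cons_smul {ι : Type*} {r : ℕ} {z : ι → ℝ} (v : Fin (r + 1) → ι → ℝ) (a : ℕ) (m : Fin r → ℕ) :
    z + ∑ j, (Fin.cons a m : Fin (r + 1) → ℕ) j • v j =
      z + a • v 0 + ∑ j, m j • v j.succ := by
  simp [Fin.sum_univ_succ, add_assoc]

/-- The part of a twisted Shintani series left over after repeated Abel summation in the first
variable. -/
noncomputable def abelRemainder {r : ℕ} (ξ : Fin (r + 1) → ℂ) (z : ι → ℝ)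
    (v : Fin (r + 1) → ι → ℝ) (K : ℕ) (p : ℕ × (Fin r → ℕ)) (s : ℂ) : ℂ :=
  ξ 0 ^ p.1 * ((∏ j, ξ j.succ ^ p.2 j) *
    (fwdDiff 1)^[K] (fun b : ℕ => prodNegPow (z + b • v 0 + ∑ j, p.2 j • v j.succ) s) p.1)

theorem exists_bound_abelRemainder {r : ℕ} {ξ : Fin (r + 1) → ℂ} (hξ : ∀ j, ‖ξ j‖ ≤ 1)
    {z : ι → ℝ} (hz : ∀ i, 0 < z i) {v : Fin (r + 1) → ι → ℝ} (hv : ∀ j i, 0 < v j i)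
    {A : ℝ} (hA : 0 ≤ A) {k : ℕ} (hk : A * Fintype.card ι ≤ k) :
    ∃ u : ℕ × (Fin r → ℕ) → ℝ, Summable u ∧ ∀ p, ∀ s ∈ Metric.ball (0 : ℂ) A,
      ‖abelRemainder ξ z v (k + 2 * (r + 1)) p s‖ ≤ u p := by
  obtain ⟨c, C, hc, hC, hvC, h⟩ := exists_linear_bounds hz hv
  obtain ⟨B, hB⟩ := exists_bound_fwdDiff_iter_prodNegPow (ι := ι) hc hC hA hk (2 * (r + 1))
  refine ⟨_, ((Fin.consEquiv fun _ => ℕ).summable_iff.2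
    (summable_inv_one_add_sum_pow (r + 1))).mul_left B, fun p s hs => ?_⟩
  rw [abelRemainder, ← mul_assoc, norm_mul]
  refine (mul_le_of_le_one_left (norm_nonneg _) ?_).trans ?_
  · simpa [Fin.prod_univ_succ] using norm_prod_pow_le_one hξ (Fin.cons p.1 p.2)
  · have hshift : (fwdDiff 1)^[k + 2 * (r + 1)]
        (fun b : ℕ => prodNegPow (z + b • v 0 + ∑ j, p.2 j • v j.succ) s) p.1 =
        (fwdDiff 1)^[k + 2 * (r + 1)] (fun b : ℕ => prodNegPow
          (z + ∑ j, (Fin.cons p.1 p.2 : Fin (r + 1) → ℕ) j • v j + b • v 0) s) 0 := by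
      rw [fwdDiff_iter_eq_sum_shift, fwdDiff_iter_eq_sum_shift]
      refine Finset.sum_congr rfl fun l _ => ?_
      rw [sum_cons_smul]
      congr 2
      simp only [smul_eq_mul, mul_one, zero_add, add_smul]
      abel
    rw [hshift]
    exact hB _ (one_le_one_add_sum _) _ (v 0) (h _) (fun i => ⟨hv 0 i, hvC 0 i⟩) s
      (by simpa using (mem_ball_zero_iff.1 hs).le)

/-- One variable of a twisted Shintani series is removed by Abel summation. -/
theorem tsum_shintani_succ [Nonempty ι] {r : ℕ} {ξ : Fin (r + 1) → ℂ} (hξ : ∀ j, ‖ξ j‖ ≤ 1)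
    (hξ0 : ξ 0 ≠ 1) {z : ι → ℝ} (hz : ∀ i, 0 < z i) {v : Fin (r + 1) → ι → ℝ}
    (hv : ∀ j i, 0 < v j i) {s : ℂ} (hs : ((2 * (r + 1) : ℕ) : ℝ) ≤ s.re) {K : ℕ}
    (hK : Summable fun p => abelRemainder ξ z v K p s) :
    ∑' m : Fin (r + 1) → ℕ, (∏ j, ξ j ^ m j) * prodNegPow (z + ∑ j, m j • v j) s =
      ∑ k ∈ Finset.range K, ξ 0 ^ k / (1 - ξ 0) ^ (k + 1) *
        (fwdDiff 1)^[k] (fun a : ℕ => ∑' m : Fin r → ℕ, (∏ j, ξ j.succ ^ m j) *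
          prodNegPow (z + a • v 0 + ∑ j, m j • v j.succ) s) 0 +
      (ξ 0 / (1 - ξ 0)) ^ K * ∑' p, abelRemainder ξ z v K p s := by
  have hsum : Summable fun p : ℕ × (Fin r → ℕ) =>
      prodNegPow (z + p.1 • v 0 + ∑ j, p.2 j • v j.succ) s := by
    refine ((Fin.consEquiv fun _ => ℕ).summable_iff.2 (summable_prodNegPow hz hv hs)).congr
      fun p => ?_
    rw [← sum_cons_smul]
    rfl
  have hsumξ : Summable fun p : ℕ × (Fin r → ℕ) =>
      (∏ j, ξ j.succ ^ p.2 j) * prodNegPow (z + p.1 • v 0 + ∑ j, p.2 j • v j.succ) s := by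
    refine Summable.of_norm_bounded hsum.norm fun p => ?_
    rw [norm_mul]
    exact mul_le_of_le_one_left (norm_nonneg _) (norm_prod_pow_le_one (fun j => hξ _) _)
  have hsumξ' : Summable fun p : ℕ × (Fin r → ℕ) => ξ 0 ^ p.1 *
      ((∏ j, ξ j.succ ^ p.2 j) * prodNegPow (z + p.1 • v 0 + ∑ j, p.2 j • v j.succ) s) := by
    refine Summable.of_norm_bounded hsumξ.norm fun p => ?_
    rw [norm_mul, norm_pow]
    exact mul_le_of_le_one_left (norm_nonneg _) (pow_le_one₀ (norm_nonneg _) (hξ 0))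
  rw [← (Fin.consEquiv fun _ => ℕ).tsum_eq]
  have hterm : ∀ p : ℕ × (Fin r → ℕ),
      (∏ j, ξ j ^ (Fin.consEquiv (fun _ => ℕ) p) j) *
        prodNegPow (z + ∑ j, (Fin.consEquiv (fun _ => ℕ) p) j • v j) s =
      ξ 0 ^ p.1 * ((∏ j, ξ j.succ ^ p.2 j) *
        prodNegPow (z + p.1 • v 0 + ∑ j, p.2 j • v j.succ) s) := by
    intro p
    rw [← sum_cons_smul, ← mul_assoc]
    congr 1
    simp [Fin.prod_univ_succ]
  rw [tsum_congr hterm, hsumξ'.tsum_prod]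
  simp only [tsum_mul_left]
  rw [tsum_pow_mul_eq_sum_fwdDiff_iter (hξ 0) hξ0 hsumξ.prod K, hK.tsum_prod]
  congr 2
  refine tsum_congr fun a => ?_
  rw [fwdDiff_iter_tsum fun b => hsumξ.prod_factor b, ← tsum_mul_left]
  refine tsum_congr fun m => ?_
  dsimp only [abelRemainder]
  rw [fwdDiff_iter_mul_left]

/-- A twisted Shintani series continues analytically to every disc around `0`, with value
`∏ j, (1 - ξ j)⁻¹` at `0` independent of the linear forms. -/
theorem exists_continuation [Nonempty ι] {A : ℝ} (hA : 0 < A) :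
    ∀ {r : ℕ} {ξ : Fin r → ℂ}, (∀ j, ‖ξ j‖ ≤ 1) → (∀ j, ξ j ≠ 1) →
    ∀ {z : ι → ℝ}, (∀ i, 0 < z i) → ∀ {v : Fin r → ι → ℝ}, (∀ j i, 0 < v j i) →
    ∃ E : ℂ → ℂ, DifferentiableOn ℂ E (Metric.ball 0 A) ∧ E 0 = ∏ j, (1 - ξ j)⁻¹ ∧
      ∀ s ∈ Metric.ball (0 : ℂ) A, ((2 * r : ℕ) : ℝ) ≤ s.re →
        E s = ∑' m : Fin r → ℕ, (∏ j, ξ j ^ m j) * prodNegPow (z + ∑ j, m j • v j) s := by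
  intro r
  induction r with
  | zero =>
    intro ξ _ _ z _ v _
    exact ⟨prodNegPow z, (differentiable_prodNegPow z).differentiableOn, by simp,
      fun s _ _ => by simp⟩
  | succ r ih =>
    intro ξ hξ hξ1 z hz v hv
    have hza : ∀ (a : ℕ) (i : ι), 0 < (z + a • v 0) i := fun a i =>
      add_pos_of_pos_of_nonneg (hz i) (nsmul_nonneg (hv 0 i).le a)
    choose E hEdiff hE0 hE using fun a : ℕ => ih (ξ := fun j => ξ j.succ) (fun j => hξ _)
      (fun j => hξ1 _) (hza a) (v := fun j => v j.succ) (fun j => hv _)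
    obtain ⟨k, hk⟩ := exists_nat_ge (A * Fintype.card ι)
    obtain ⟨u, hu, hbound⟩ := exists_bound_abelRemainder hξ hz hv hA.le hk
    set K := k + 2 * (r + 1) with hK
    have hball0 : (0 : ℂ) ∈ Metric.ball (0 : ℂ) A := Metric.mem_ball_self hA
    refine ⟨fun s => ∑ k ∈ Finset.range K, ξ 0 ^ k / (1 - ξ 0) ^ (k + 1) *
      (fwdDiff 1)^[k] (fun a : ℕ => E a s) 0 +
      (ξ 0 / (1 - ξ 0)) ^ K * ∑' p, abelRemainder ξ z v K p s, ?_, ?_, ?_⟩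
    · refine (DifferentiableOn.fun_sum fun k _ =>
        (differentiable_fwdDiff_iter _ hEdiff _ _).const_mul _).add
        (DifferentiableOn.const_mul ?_ _)
      refine Complex.differentiableOn_tsum_of_summable_norm hu (fun p => ?_) Metric.isOpen_ball
        hbound
      exact ((differentiable_fwdDiff_iter _ (fun b =>
        (differentiable_prodNegPow _).differentiableOn) _ _).const_mul _).const_mul _
    · obtain ⟨K', hK'⟩ : ∃ K', K = K' + 1 := ⟨k + 2 * r + 1, by omega⟩
      have hrem : ∀ p, abelRemainder ξ z v K p 0 = 0 := fun p => by
        simp only [abelRemainder, prodNegPow_zero, hK', fwdDiff_iter_succ_const, mul_zero]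
      simp only [hrem, tsum_zero, mul_zero, add_zero, hE0]
      rw [hK', Finset.sum_range_succ', Finset.sum_eq_zero, Fin.prod_univ_succ]
      · simp
      · intro l _
        rw [fwdDiff_iter_succ_const, mul_zero]
    · intro s hs hre
      rw [tsum_shintani_succ hξ (hξ1 0) hz hv hre
        (Summable.of_norm_bounded hu fun p => hbound p s hs)]
      have : ∀ a, E a s = ∑' m : Fin r → ℕ, (∏ j, ξ j.succ ^ m j) *
          prodNegPow (z + a • v 0 + ∑ j, m j • v j.succ) s := fun a =>
        hE a s hs (le_trans (by push_cast; linarith) hre)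
      simp only [this]

theorem continuation_apply_zero [Nonempty ι] {r : ℕ} {ξ : Fin r → ℂ} (hξ : ∀ j, ‖ξ j‖ ≤ 1)
    (hξ1 : ∀ j, ξ j ≠ 1) {z : ι → ℝ} (hz : ∀ i, 0 < z i) {v : Fin r → ι → ℝ}
    (hv : ∀ j i, 0 < v j i) {U : Set ℂ} (hUo : IsOpen U) (hUc : IsConnected U)
    (hU0 : (0 : ℂ) ∈ U) {x : ℝ} (hUx : {s : ℂ | x < s.re} ⊆ U) {f : ℂ → ℂ}
    (hf : AnalyticOnNhd ℂ f U)
    (hfs : ∀ s : ℂ, x < s.re →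
      f s = ∑' m : Fin r → ℕ, (∏ j, ξ j ^ m j) * prodNegPow (z + ∑ j, m j • v j) s) :
    f 0 = ∏ j, (1 - ξ j)⁻¹ := by
  set y : ℝ := max x (2 * r : ℕ) with hy
  have hyU : ((y + 1 : ℝ) : ℂ) ∈ U := hUx (by
    simp only [Set.mem_ofPred_eq, Complex.ofReal_re]
    linarith [le_max_left x ((2 * r : ℕ) : ℝ)])
  obtain ⟨γ, hγ⟩ := (hUo.isConnected_iff_isPathConnected.1 hUc).joinedIn _ hU0 _ hyU
  obtain ⟨A, hA, hγA⟩ := (isCompact_range γ.continuous).isBounded.subset_ball_lt 0 0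
  obtain ⟨E, hEdiff, hE0, hE⟩ := exists_continuation hA hξ hξ1 hz hv
  have h0 : (0 : ℂ) ∈ Set.range γ := ⟨0, γ.source⟩
  have h1 : ((y + 1 : ℝ) : ℂ) ∈ Set.range γ := ⟨1, γ.target⟩
  have hγU : Set.range γ ⊆ U := Set.range_subset_iff.2 hγ
  rw [← hE0]
  refine AnalyticOnNhd.eqOn_of_preconnected_of_eventuallyEq (hf.mono hγU)
    ((hEdiff.analyticOnNhd Metric.isOpen_ball).mono hγA) (isPreconnected_range γ.continuous)
    h1 ?_ h0
  have hopen : IsOpen {s : ℂ | y < s.re} := isOpen_lt continuous_const Complex.continuous_re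
  filter_upwards [Metric.isOpen_ball.mem_nhds (hγA h1), hopen.mem_nhds (by simp)] with s hs hs'
  rw [hfs s ((le_max_left _ _).trans_lt hs'), hE s hs ((le_max_right _ _).trans hs'.le)]

end shintani

section totallyReal

variable {F : Type*} [Field F]

/-- The real embedding underlying a complex embedding with real values. -/
noncomputable def realEmbedding (htr : IsTotallyRealField F) (φ : F →+* ℂ) : F →+* ℝ where
  toFun x := (φ x).re
  map_one' := by simp
  map_mul' x y := by simp [htr φ x]
  map_zero' := by simp
  map_add' x y := by simp

theorem ofReal_realEmbedding (htr : IsTotallyRealField F) (φ : F →+* ℂ) (x : F) :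
    (realEmbedding htr φ x : ℂ) = φ x :=
  Complex.ext rfl (by simp [htr φ x])

theorem norm_eq_prod_realEmbedding [NumberField F] (htr : IsTotallyRealField F) (x : F) :
    ((Algebra.norm ℚ x : ℚ) : ℝ) = ∏ φ : F →ₐ[ℚ] ℂ, realEmbedding htr φ.toRingHom x := by
  have h := Algebra.norm_eq_prod_embeddings ℚ ℂ x
  apply Complex.ofReal_injective
  push_cast
  rw [eq_ratCast] at h
  rw [h]
  exact Finset.prod_congr rfl fun φ _ => (ofReal_realEmbedding htr φ.toRingHom x).symm

end totallyReal

/-- The root-of-unity-twisted Shintani zeta function with the norm and the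
one attached to a single real embedding `σ` have the same value at `s = 0`. -/
theorem norm_and_embedding_zeta_agree_at_zero (F : Type*) [Field F] [NumberField F]
    (htr : IsTotallyRealField F) (σ : F →+* ℝ) (r : ℕ) (hr : 1 ≤ r)
    (z : F) (hz : ∀ τ : F →+* ℝ, 0 < τ z)
    (v : Fin r → F) (hv : ∀ i, ∀ τ : F →+* ℝ, 0 < τ (v i))
    (ξ : Fin r → ℂ) (hξroot : ∀ j, ∃ nn : ℕ, 0 < nn ∧ ξ j ^ nn = 1) (hξne : ∀ j, ξ j ≠ 1)
    (Uf : Set ℂ) (hUfopen : IsOpen Uf) (hUfconn : IsConnected Uf)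
    (hUf0 : (0 : ℂ) ∈ Uf) (hUfhp : {s : ℂ | (r : ℝ) < s.re} ⊆ Uf)
    (f : ℂ → ℂ) (hf : AnalyticOnNhd ℂ f Uf)
    (hfs : ∀ s : ℂ, (r : ℝ) < s.re →
      f s = ∑' m : Fin r → ℕ,
        (∏ j, ξ j ^ m j) *
          Complex.exp (-s *
            (Real.log ((Algebra.norm ℚ (z + ∑ i, (m i : ℕ) • v i) : ℚ) : ℝ) : ℂ)))
    (Ug : Set ℂ) (hUgopen : IsOpen Ug) (hUgconn : IsConnected Ug)
    (hUg0 : (0 : ℂ) ∈ Ug) (hUghp : {s : ℂ | (r : ℝ) < s.re} ⊆ Ug)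
    (g : ℂ → ℂ) (hg : AnalyticOnNhd ℂ g Ug)
    (hgs : ∀ s : ℂ, (r : ℝ) < s.re →
      g s = ∑' m : Fin r → ℕ,
        (∏ j, ξ j ^ m j) *
          Complex.exp (-s * (Real.log (σ (z + ∑ i, (m i : ℕ) • v i)) : ℂ))) :
    f 0 = g 0 := by
  have hξ : ∀ j, ‖ξ j‖ ≤ 1 := fun j => by
    obtain ⟨k, hk, h⟩ := hξroot j
    exact (Complex.norm_eq_one_of_pow_eq_one h hk.ne').le
  have hgval : g 0 = ∏ j, (1 - ξ j)⁻¹ := by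
    refine continuation_apply_zero (ι := Unit) hξ hξne (z := fun _ => σ z) (fun _ => hz σ)
      (v := fun j _ => σ (v j)) (fun j _ => hv j σ) hUgopen hUgconn hUg0 hUghp hg
      fun s hs => (hgs s hs).trans (tsum_congr fun m => ?_)
    simp [prodNegPow]
  have hne : Nonempty (F →ₐ[ℚ] ℂ) := ⟨(algebraMap ℝ ℂ).comp σ |>.toRatAlgHom⟩
  have hfval : f 0 = ∏ j, (1 - ξ j)⁻¹ := by
    refine continuation_apply_zero (ι := F →ₐ[ℚ] ℂ) hξ hξne
      (z := fun φ => realEmbedding htr φ.toRingHom z) (fun φ => hz (realEmbedding htr φ.toRingHom))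
      (v := fun j φ => realEmbedding htr φ.toRingHom (v j)) (fun j φ => hv j (realEmbedding htr φ.toRingHom)) hUfopen
      hUfconn hUf0 hUfhp hf fun s hs => (hfs s hs).trans (tsum_congr fun m => ?_)
    have hpos : ∀ τ : F →+* ℝ, 0 < τ (z + ∑ i, m i • v i) := fun τ => by
      rw [map_add, map_sum]
      refine add_pos_of_pos_of_nonneg (hz τ) (Finset.sum_nonneg fun i _ => ?_)
      rw [map_nsmul]
      exact nsmul_nonneg (hv i τ).le _
    rw [norm_eq_prod_realEmbedding htr, Real.log_prod fun φ _ => (hpos _).ne', prodNegPow,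
      Complex.ofReal_sum]
    simp [Finset.sum_apply]
  rw [hfval, hgval]
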